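/- arXiv:2010.06140 — 4 statements merged into one kernel-verified Lean document; each statement's English description precedes it below -/
import Mathlib

section
/- Let X ⊆ ℝⁿ be a nonempty convex set and let f₁,…,f_p : ℝⁿ → ℝ (p ≥ 2) each be convex on X. If x* ∈ X is an efficient solution of the multiobjective problem min_{x∈X} (f₁(x),…,f_p(x)), then there exists a weighting vector w ∈ ℝᵖ with w ≥ 0 componentwise and Σₗ wₗ = 1 such that x* minimizes the weighted sum Σₗ wₗ fₗ(x) over all x ∈ X. -/
/-- For a convex multiobjective problem, every efficient solution minimizes
some weighted sum of the objectives with nonnegative weights summing to one. -/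
theorem efficient_is_weighted_sum_min_of_convex
    {n p : ℕ} (hp : 2 ≤ p)
    (X : Set (EuclideanSpace ℝ (Fin n))) (hX : X.Nonempty) (hXconv : Convex ℝ X)
    (f : Fin p → EuclideanSpace ℝ (Fin n) → ℝ)
    (hf : ∀ l, ConvexOn ℝ X (f l))
    (xstar : EuclideanSpace ℝ (Fin n)) (hxstar : xstar ∈ X)
    (heff : ¬ ∃ x ∈ X, (∀ i, f i x ≤ f i xstar) ∧ ∃ k, f k x < f k xstar) :
    ∃ w : Fin p → ℝ, (∀ l, 0 ≤ w l) ∧ (∑ l, w l = 1) ∧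
      ∀ x ∈ X, ∑ l, w l * f l xstar ≤ ∑ l, w l * f l x := by
  let s : Set (Fin p → ℝ) := {y | ∀ i, y i < 0}
  let t : Set (Fin p → ℝ) := {y | ∃ x ∈ X, ∀ i, f i x - f i xstar ≤ y i}
  have hs1 : Convex ℝ s := by
    have : s = Set.pi Set.univ (fun _ => Set.Iio (0:ℝ)) := by
      ext y; simp [s]
    rw [this]
    exact convex_pi (fun i _ => convex_Iio 0)
  have hs2 : IsOpen s := by
    have : s = Set.pi Set.univ (fun _ => Set.Iio (0:ℝ)) := by
      ext y; simp [s]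
    rw [this]
    exact isOpen_set_pi Set.finite_univ (fun i _ => isOpen_Iio)
  have ht : Convex ℝ t := by
    rintro y ⟨x, hx, hxy⟩ z ⟨x', hx', hxz⟩ a b ha hb hab
    refine ⟨a • x + b • x', hXconv hx hx' ha hb hab, fun i => ?_⟩
    have h1 := (hf i).2 hx hx' ha hb hab
    have h2 := mul_le_mul_of_nonneg_left (hxy i) ha
    have h3 := mul_le_mul_of_nonneg_left (hxz i) hb
    simp only [smul_eq_mul, Pi.add_apply, Pi.smul_apply] at *
    have h4 : f i xstar = a * f i xstar + b * f i xstar := by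
      rw [← add_mul, hab, one_mul]
    linarith
  have hdisj : Disjoint s t := by
    rw [Set.disjoint_left]
    rintro y hy ⟨x, hx, hxy⟩
    have hlt : ∀ i, f i x < f i xstar := fun i => by
      have h1 := hxy i
      have h2 : y i < 0 := hy i
      linarith
    exact heff ⟨x, hx, fun i => (hlt i).le, ⟨0, by omega⟩, hlt _⟩
  obtain ⟨g, u, hgs, hgt⟩ := geometric_hahn_banach_open hs1 hs2 ht hdisj
  let c : Fin p → ℝ := fun i => g (Pi.single i 1)
  have hg : ∀ y : Fin p → ℝ, g y = ∑ i, c i * y i := by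
    intro y
    have := LinearMap.pi_apply_eq_sum_univ (g : (Fin p → ℝ) →ₗ[ℝ] ℝ) y
    simp only [ContinuousLinearMap.coe_coe, smul_eq_mul] at this
    rw [this]
    refine Finset.sum_congr rfl fun i _ => ?_
    rw [mul_comm]
    congr 2
    ext j
    simp [Pi.single_apply, eq_comm]
  have hu0 : u ≤ 0 := by
    have := hgt 0 ⟨xstar, hxstar, fun i => by simp⟩
    simpa using this
  have hray : ∀ i, ∀ r : ℝ, 0 ≤ r → u ≤ r * c i := by
    intro i r hr
    have h := hgt (r • Pi.single i 1) ⟨xstar, hxstar, fun j => by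
      simp only [sub_self, Pi.smul_apply, smul_eq_mul, Pi.single_apply]
      split_ifs <;> simp [hr]⟩
    simpa using h
  have hneg : ∀ r : ℝ, 0 < r → -(r * ∑ i, c i) < u := by
    intro r hr
    have h := hgs (fun _ => -r) (fun i => by simpa using hr)
    rw [hg, ← Finset.sum_mul] at h
    linarith
  have hS : 0 < ∑ i, c i := by
    have := hneg 1 one_pos
    linarith
  have hu : u = 0 := by
    by_contra hne
    have hlt : u < 0 := lt_of_le_of_ne hu0 hne
    have h := hneg (-u / ∑ i, c i) (div_pos (by linarith) hS)
    rw [div_mul_cancel₀ _ hS.ne'] at h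
    linarith
  have hc : ∀ i, 0 ≤ c i := fun i => by
    have := hray i 1 zero_le_one
    linarith
  refine ⟨fun i => c i / ∑ j, c j, fun i => div_nonneg (hc i) hS.le, ?_, ?_⟩
  · rw [← Finset.sum_div, div_self hS.ne']
  · intro x hx
    have h := hgt (fun i => f i x - f i xstar) ⟨x, hx, fun i => le_rfl⟩
    rw [hg, hu] at h
    simp only [mul_sub, Finset.sum_sub_distrib] at h
    simp only [div_mul_eq_mul_div, ← Finset.sum_div]
    exact div_le_div_of_nonneg_right (by linarith) hS.le
end

section
/- Let C ⊆ ℝⁿ be a nonempty convex set, let λ > 0, and let g₁, g₂ : ℝⁿ → ℝ be differentiable λ-strongly convex functions (i.e. ⟨∇gᵢ(y) − ∇gᵢ(x), y − x⟩ ≥ λ‖y − x‖² for all x, y). Suppose the difference h = g₁ − g₂ is ε-Lipschitz on C, i.e. |h(x) − h(y)| ≤ ε‖x − y‖ for all x, y ∈ C. If x₁ minimizes g₁ over C and x₂ minimizes g₂ over C, then ‖x₁ − x₂‖ ≤ 2ε/λ. -/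
open scoped RealInnerProductSpace

theorem growth_aux {n : ℕ} (lam : ℝ)
    (C : Set (EuclideanSpace ℝ (Fin n))) (hC : Convex ℝ C)
    (g : EuclideanSpace ℝ (Fin n) → ℝ)
    (g' : EuclideanSpace ℝ (Fin n) → EuclideanSpace ℝ (Fin n))
    (hgrad : ∀ x, HasGradientAt g (g' x) x)
    (hmono : ∀ x y, lam * ‖y - x‖ ^ 2 ≤ ⟪g' y - g' x, y - x⟫)
    (x y : EuclideanSpace ℝ (Fin n)) (hx : x ∈ C) (hy : y ∈ C)
    (hmin : ∀ z ∈ C, g x ≤ g z) :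
    g x + lam / 2 * ‖y - x‖ ^ 2 ≤ g y := by
  have h0 : 0 ≤ ⟪g' x, y - x⟫ := by
    have hl : IsLocalMinOn g C x := IsMinOn.localize (fun z hz => hmin z hz)
    have := hl.hasFDerivWithinAt_nonneg (hgrad x).hasFDerivAt.hasFDerivWithinAt
      (sub_mem_posTangentConeAt_of_segment_subset (hC.segment_subset hx hy))
    simpa using this
  have hd : ∀ t : ℝ, HasDerivAt (fun t : ℝ => g (x + t • (y - x)) - lam / 2 * ‖y - x‖ ^ 2 * t ^ 2)
      (⟪g' (x + t • (y - x)), y - x⟫ - lam * ‖y - x‖ ^ 2 * t) t := by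
    intro t
    have h1 : HasDerivAt (fun t : ℝ => x + t • (y - x)) (y - x) t := by
      simpa using ((hasDerivAt_id t).smul_const (y - x)).const_add x
    have h2 := (hgrad (x + t • (y - x))).hasFDerivAt.comp_hasDerivAt t h1
    have h3 := ((hasDerivAt_id t).pow 2).const_mul (lam / 2 * ‖y - x‖ ^ 2)
    refine HasDerivAt.congr_deriv (h2.sub h3) ?_
    simp
    ring
  have hm : MonotoneOn (fun t : ℝ => g (x + t • (y - x)) - lam / 2 * ‖y - x‖ ^ 2 * t ^ 2)
      (Set.Icc 0 1) := by
    apply monotoneOn_of_deriv_nonneg (convex_Icc 0 1)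
    · exact fun t _ => (hd t).continuousAt.continuousWithinAt
    · exact fun t _ => (hd t).differentiableAt.differentiableWithinAt
    · intro t ht
      rw [interior_Icc] at ht
      rw [(hd t).deriv]
      have h := hmono x (x + t • (y - x))
      rw [add_sub_cancel_left, norm_smul, inner_smul_right, inner_sub_left, mul_pow,
        Real.norm_eq_abs, sq_abs] at h
      have ht0 : 0 < t := ht.1
      have : t * (lam * ‖y - x‖ ^ 2 * t) ≤ t * (⟪g' (x + t • (y - x)), y - x⟫ - ⟪g' x, y - x⟫) := by
        linarith
      have := le_of_mul_le_mul_left this ht0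
      linarith
  have := hm (Set.left_mem_Icc.2 zero_le_one) (Set.right_mem_Icc.2 zero_le_one) zero_le_one
  simp at this
  linarith

/-- If two `λ`-strongly convex differentiable functions differ by an
`ε`-Lipschitz function on a convex set `C`, then their minimizers over `C` are at
distance at most `2ε/λ`. -/
theorem strongly_convex_min_perturbation_bound
    {n : ℕ} (lam ε : ℝ) (hlam : 0 < lam) (hε : 0 ≤ ε)
    (C : Set (EuclideanSpace ℝ (Fin n))) (hCne : C.Nonempty) (hC : Convex ℝ C)
    (g₁ g₂ : EuclideanSpace ℝ (Fin n) → ℝ)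
    (g₁' g₂' : EuclideanSpace ℝ (Fin n) → EuclideanSpace ℝ (Fin n))
    (hgrad₁ : ∀ x, HasGradientAt g₁ (g₁' x) x)
    (hgrad₂ : ∀ x, HasGradientAt g₂ (g₂' x) x)
    (hmono₁ : ∀ x y, lam * ‖y - x‖ ^ 2 ≤ ⟪g₁' y - g₁' x, y - x⟫)
    (hmono₂ : ∀ x y, lam * ‖y - x‖ ^ 2 ≤ ⟪g₂' y - g₂' x, y - x⟫)
    (hlip : ∀ x ∈ C, ∀ y ∈ C,
      |(g₁ x - g₂ x) - (g₁ y - g₂ y)| ≤ ε * ‖x - y‖)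
    (x₁ x₂ : EuclideanSpace ℝ (Fin n)) (hx₁ : x₁ ∈ C) (hx₂ : x₂ ∈ C)
    (hmin₁ : ∀ x ∈ C, g₁ x₁ ≤ g₁ x) (hmin₂ : ∀ x ∈ C, g₂ x₂ ≤ g₂ x) :
    ‖x₁ - x₂‖ ≤ 2 * ε / lam := by
  have h1 := growth_aux lam C hC g₁ g₁' hgrad₁ hmono₁ x₁ x₂ hx₁ hx₂ hmin₁
  have h2 := hmin₂ x₁ hx₁
  have h3 := (abs_le.1 (hlip x₁ hx₁ x₂ hx₂)).1
  rw [norm_sub_rev] at h1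
  rw [le_div_iff₀ hlam]
  rcases (norm_nonneg (x₁ - x₂)).eq_or_lt with h | h
  · rw [← h]; linarith
  · refine le_of_mul_le_mul_left ?_ h
    linarith
end

section
/- Let Θ ⊆ ℝ^{n_θ}, let X ⊆ ℝⁿ be a nonempty closed convex set contained in the closed ball of radius B, let λ > 0, κ > 0, R > 0, and let f(·, θ) = (f₁(·, θ),…,f_p(·, θ)) be objective functions such that: (i) for every θ ∈ Θ and every w in the probability simplex 𝒲_p, the function x ↦ wᵀf(x, θ) is differentiable with ⟨∇ₓwᵀf(y, θ) − ∇ₓwᵀf(x, θ), y − x⟩ ≥ λ‖y − x‖², so that it has a unique minimizer S(w, θ) over X; (ii) for all θ₁, θ₂ ∈ Θ and all w ∈ 𝒲_p, the function x ↦ wᵀf(x, θ₁) − wᵀf(x, θ₂) is κ‖θ₁ − θ₂‖-Lipschitz on X. Define the loss l(y, θ) = inf_{w ∈ 𝒲_p} ‖y − S(w, θ)‖². Then for every y ∈ ℝⁿ with ‖y‖ ≤ R and all θ₁, θ₂ ∈ Θ, |l(y, θ₁) − l(y, θ₂)| ≤ (4(B + R)κ/λ)‖θ₁ − θ₂‖;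 i.e., the loss is uniformly (4(B + R)κ/λ)-Lipschitz continuous in θ. -/
open scoped RealInnerProductSpace

theorem quad_growth_aux {E : Type*} [NormedAddCommGroup E] [InnerProductSpace ℝ E] [CompleteSpace E]
    (X : Set E) (hX : Convex ℝ X) (F : E → ℝ) (G : E → E) (lam : ℝ)
    (hG : ∀ x, HasGradientAt F (G x) x)
    (hm : ∀ x y, lam * ‖y - x‖ ^ 2 ≤ ⟪G y - G x, y - x⟫)
    (s : E) (hs : s ∈ X) (hmin : ∀ x ∈ X, F s ≤ F x) (x : E) (hx : x ∈ X) :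
    lam / 2 * ‖x - s‖ ^ 2 ≤ F x - F s := by
  have h0 : 0 ≤ ⟪G s, x - s⟫ := by
    have hl : IsLocalMinOn F X s := IsMinOn.localize (fun z hz => hmin z hz)
    have := hl.hasFDerivWithinAt_nonneg (hG s).hasFDerivAt.hasFDerivWithinAt
      (sub_mem_posTangentConeAt_of_segment_subset (hX.segment_subset hs hx))
    simpa using this
  have hd : ∀ t : ℝ, HasDerivAt (fun t : ℝ => F (s + t • (x - s)) - lam / 2 * ‖x - s‖ ^ 2 * t ^ 2)
      (⟪G (s + t • (x - s)), x - s⟫ - lam * ‖x - s‖ ^ 2 * t) t := by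
    intro t
    have h1 : HasDerivAt (fun t : ℝ => s + t • (x - s)) (x - s) t := by
      simpa using ((hasDerivAt_id t).smul_const (x - s)).const_add s
    have h2 := (hG (s + t • (x - s))).hasFDerivAt.comp_hasDerivAt t h1
    have h3 := h2.sub (((hasDerivAt_id t).pow 2).const_mul (lam / 2 * ‖x - s‖ ^ 2))
    refine h3.congr_deriv ?_
    simp
    ring
  obtain ⟨c, hc, hc'⟩ := exists_hasDerivAt_eq_slope _ _ (zero_lt_one' ℝ)
    (fun t _ => (hd t).continuousAt.continuousWithinAt) (fun t _ => hd t)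
  have h4 := hm s (s + c • (x - s))
  simp only [add_sub_cancel_left, inner_smul_right, norm_smul, inner_sub_left, mul_pow,
    Real.norm_eq_abs, sq_abs] at h4
  have h5 : lam * ‖x - s‖ ^ 2 * c ≤ ⟪G (s + c • (x - s)), x - s⟫ - ⟪G s, x - s⟫ := by
    refine le_of_mul_le_mul_left ?_ hc.1
    linarith
  simp at hc'
  linarith

theorem sInf_aux {W : Type*} (P : Set W) (a b : W → ℝ) (C : ℝ) (hC : 0 ≤ C)
    (ha : ∀ w ∈ P, 0 ≤ a w) (hab : ∀ w ∈ P, a w ≤ b w + C) :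
    sInf {r : ℝ | ∃ w ∈ P, r = a w} - sInf {r : ℝ | ∃ w ∈ P, r = b w} ≤ C := by
  rcases P.eq_empty_or_nonempty with h | ⟨w0, hw0⟩
  · subst h
    simpa using hC
  · have : sInf {r : ℝ | ∃ w ∈ P, r = a w} - C ≤ sInf {r : ℝ | ∃ w ∈ P, r = b w} := by
      refine le_csInf ⟨_, w0, hw0, rfl⟩ ?_
      rintro _ ⟨w, hw, rfl⟩
      have : sInf {r : ℝ | ∃ w ∈ P, r = a w} ≤ a w :=
        csInf_le ⟨0, by rintro _ ⟨w, hw, rfl⟩; exact ha w hw⟩ ⟨w, hw, rfl⟩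
      linarith [hab w hw]
    linarith

/-- Lemma 1 of the paper: under strong convexity of the weighted objectives
and Lipschitz continuity of the objective perturbation in `θ`, the loss
`l(y, θ) = inf_{w ∈ 𝒲_p} ‖y − S(w, θ)‖²` is uniformly `(4(B+R)κ/λ)`-Lipschitz in `θ`. -/
theorem loss_function_uniformly_lipschitz
    {n nθ p : ℕ}
    (Θ : Set (EuclideanSpace ℝ (Fin nθ)))
    (X : Set (EuclideanSpace ℝ (Fin n)))
    (hXne : X.Nonempty) (hXcl : IsClosed X) (hXconv : Convex ℝ X)
    (B lam κ R : ℝ) (hB : 0 < B) (hlam : 0 < lam) (hκ : 0 < κ) (hR : 0 < R)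
    (hXB : ∀ x ∈ X, ‖x‖ ≤ B)
    (f : Fin p → EuclideanSpace ℝ (Fin n) → EuclideanSpace ℝ (Fin nθ) → ℝ)
    (G : (Fin p → ℝ) → EuclideanSpace ℝ (Fin nθ) →
      EuclideanSpace ℝ (Fin n) → EuclideanSpace ℝ (Fin n))
    (hgrad : ∀ w ∈ {w : Fin p → ℝ | (∀ l, 0 ≤ w l) ∧ ∑ l, w l = 1}, ∀ θ ∈ Θ, ∀ x,
      HasGradientAt (fun z => ∑ l, w l * f l z θ) (G w θ x) x)
    (hmono : ∀ w ∈ {w : Fin p → ℝ | (∀ l, 0 ≤ w l) ∧ ∑ l, w l = 1}, ∀ θ ∈ Θ, ∀ x y,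
      lam * ‖y - x‖ ^ 2 ≤ ⟪G w θ y - G w θ x, y - x⟫)
    (S : (Fin p → ℝ) → EuclideanSpace ℝ (Fin nθ) → EuclideanSpace ℝ (Fin n))
    (hS : ∀ w ∈ {w : Fin p → ℝ | (∀ l, 0 ≤ w l) ∧ ∑ l, w l = 1}, ∀ θ ∈ Θ,
      S w θ ∈ X ∧ ∀ x ∈ X, ∑ l, w l * f l (S w θ) θ ≤ ∑ l, w l * f l x θ)
    (hlip : ∀ θ₁ ∈ Θ, ∀ θ₂ ∈ Θ,
      ∀ w ∈ {w : Fin p → ℝ | (∀ l, 0 ≤ w l) ∧ ∑ l, w l = 1}, ∀ x ∈ X, ∀ y ∈ X,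
      |(∑ l, w l * f l x θ₁ - ∑ l, w l * f l x θ₂)
          - (∑ l, w l * f l y θ₁ - ∑ l, w l * f l y θ₂)|
        ≤ κ * ‖θ₁ - θ₂‖ * ‖x - y‖)
    (loss : EuclideanSpace ℝ (Fin n) → EuclideanSpace ℝ (Fin nθ) → ℝ)
    (hloss : ∀ y θ, loss y θ =
      sInf {r : ℝ | ∃ w ∈ {w : Fin p → ℝ | (∀ l, 0 ≤ w l) ∧ ∑ l, w l = 1},
        r = ‖y - S w θ‖ ^ 2}) :
    ∀ y : EuclideanSpace ℝ (Fin n), ‖y‖ ≤ R → ∀ θ₁ ∈ Θ, ∀ θ₂ ∈ Θ,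
      |loss y θ₁ - loss y θ₂| ≤ 4 * (B + R) * κ / lam * ‖θ₁ - θ₂‖ := by
  intro y hy
  have hdist : ∀ θ₁ ∈ Θ, ∀ θ₂ ∈ Θ,
      ∀ w ∈ {w : Fin p → ℝ | (∀ l, 0 ≤ w l) ∧ ∑ l, w l = 1},
      ‖S w θ₂ - S w θ₁‖ ≤ 2 * κ / lam * ‖θ₁ - θ₂‖ := by
    intro θ₁ h1 θ₂ h2 w hw
    obtain ⟨ha, hamin⟩ := hS w hw θ₁ h1
    obtain ⟨hb, hbmin⟩ := hS w hw θ₂ h2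
    have hq := quad_growth_aux X hXconv (fun z => ∑ l, w l * f l z θ₁) (G w θ₁) lam
      (hgrad w hw θ₁ h1) (hmono w hw θ₁ h1) _ ha hamin _ hb
    have hl := (le_abs_self _).trans (hlip θ₁ h1 θ₂ h2 w hw _ hb _ ha)
    have hb2 := hbmin _ ha
    rcases (norm_nonneg (S w θ₂ - S w θ₁)).eq_or_lt with h0 | h0
    · rw [← h0]; positivity
    · have : lam / 2 * ‖S w θ₂ - S w θ₁‖ ≤ κ * ‖θ₁ - θ₂‖ := by
        refine le_of_mul_le_mul_right ?_ h0
        linarith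
      rw [div_mul_eq_mul_div, le_div_iff₀ hlam]
      linarith
  have hone : ∀ θ₁ ∈ Θ, ∀ θ₂ ∈ Θ,
      loss y θ₁ - loss y θ₂ ≤ 4 * (B + R) * κ / lam * ‖θ₁ - θ₂‖ := by
    intro θ₁ h1 θ₂ h2
    rw [hloss, hloss]
    refine sInf_aux _ (fun w => ‖y - S w θ₁‖ ^ 2) (fun w => ‖y - S w θ₂‖ ^ 2) _ (by positivity)
      (fun w _ => by positivity) ?_
    intro w hw
    have hd := hdist θ₁ h1 θ₂ h2 w hw
    have e1 : ‖y - S w θ₁‖ ≤ B + R := by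
      linarith [norm_sub_le y (S w θ₁), hXB _ (hS w hw θ₁ h1).1]
    have e2 : ‖y - S w θ₂‖ ≤ B + R := by
      linarith [norm_sub_le y (S w θ₂), hXB _ (hS w hw θ₂ h2).1]
    have e3 : ‖y - S w θ₁‖ ≤ ‖y - S w θ₂‖ + ‖S w θ₂ - S w θ₁‖ := by
      have := norm_add_le (y - S w θ₂) (S w θ₂ - S w θ₁)
      simpa using this
    have e4 : 4 * (B + R) * κ / lam * ‖θ₁ - θ₂‖
        = 2 * (B + R) * (2 * κ / lam * ‖θ₁ - θ₂‖) := by ring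
    rw [e4]
    have e5 : 2 * (B + R) * ‖S w θ₂ - S w θ₁‖ ≤ 2 * (B + R) * (2 * κ / lam * ‖θ₁ - θ₂‖) := by
      gcongr
    have p1 := norm_nonneg (y - S w θ₁)
    have p2 := norm_nonneg (y - S w θ₂)
    have p3 := norm_nonneg (S w θ₂ - S w θ₁)
    have e6 : (‖y - S w θ₁‖ + ‖y - S w θ₂‖) * (‖y - S w θ₁‖ - ‖y - S w θ₂‖)
        ≤ (2 * (B + R)) * ‖S w θ₂ - S w θ₁‖ := by
      refine (mul_le_mul_of_nonneg_left (by linarith) (by linarith)).trans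
        (mul_le_mul_of_nonneg_right (by linarith) p3)
    nlinarith
  intro θ₁ h1 θ₂ h2
  rw [abs_le]
  have := hone θ₂ h2 θ₁ h1
  rw [norm_sub_rev] at this
  exact ⟨by linarith, hone θ₁ h1 θ₂ h2⟩
end

section
/- Let Θ ⊆ ℝᵐ be a nonempty closed convex set, η > 0, L > 0, θ₀ ∈ Θ, and let l : ℝᵐ → ℝ be convex, nonnegative, and L-Lipschitz on Θ. Let θ⁺ minimize G(θ) = ½‖θ − θ₀‖² + η·l(θ) over Θ. Then for every θ* ∈ Θ: η(l(θ₀) − l(θ*)) ≤ η²L²/2 + ½(‖θ₀ − θ*‖² − ‖θ⁺ − θ*‖²). -/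
/-- Per-round regret inequality for the implicit online update:
if `l` is convex, nonnegative and `L`-Lipschitz on `Θ`, and `θ⁺` minimizes
`G(θ) = ½‖θ − θ₀‖² + η·l(θ)` over `Θ`, then for every `θ* ∈ Θ`,
`η(l(θ₀) − l(θ*)) ≤ η²L²/2 + ½(‖θ₀ − θ*‖² − ‖θ⁺ − θ*‖²)`. -/
theorem implicit_update_per_round_regret
    {m : ℕ} (Θ : Set (EuclideanSpace ℝ (Fin m)))
    (hΘne : Θ.Nonempty) (hΘcl : IsClosed Θ) (hΘconv : Convex ℝ Θ)
    (η L : ℝ) (hη : 0 < η) (hL : 0 < L)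
    (θ₀ : EuclideanSpace ℝ (Fin m)) (hθ₀ : θ₀ ∈ Θ)
    (l : EuclideanSpace ℝ (Fin m) → ℝ)
    (hconv : ConvexOn ℝ Θ l)
    (hnonneg : ∀ θ ∈ Θ, 0 ≤ l θ)
    (hlip : ∀ x ∈ Θ, ∀ y ∈ Θ, |l x - l y| ≤ L * ‖x - y‖)
    (θplus : EuclideanSpace ℝ (Fin m)) (hθplus : θplus ∈ Θ)
    (hmin : ∀ θ ∈ Θ,
      (1 / 2) * ‖θplus - θ₀‖ ^ 2 + η * l θplus ≤ (1 / 2) * ‖θ - θ₀‖ ^ 2 + η * l θ) :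
    ∀ θstar ∈ Θ,
      η * (l θ₀ - l θstar)
        ≤ η ^ 2 * L ^ 2 / 2 + (1 / 2) * (‖θ₀ - θstar‖ ^ 2 - ‖θplus - θstar‖ ^ 2) := by
  intro s hs
  have key : 0 ≤ inner ℝ (θplus - θ₀) (s - θplus) + η * (l s - l θplus) := by
    by_contra! hA
    set I := inner ℝ (θplus - θ₀) (s - θplus) with hI
    set A := I + η * (l s - l θplus) with hAdef
    set N := ‖s - θplus‖ ^ 2 with hN
    have hN0 : 0 ≤ N := by positivity
    have hD : 0 < N + 1 - A := by linarith
    set t := -A / (N + 1 - A) with ht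
    have htD : t * (N + 1 - A) = -A := by rw [ht]; field_simp
    have ht0 : 0 < t := div_pos (by linarith) hD
    have ht1 : t ≤ 1 := by rw [ht, div_le_one hD]; linarith
    have hmem := hΘconv hθplus hs (sub_nonneg.2 ht1) ht0.le (by ring)
    have hc := hconv.2 hθplus hs (sub_nonneg.2 ht1) ht0.le (by ring)
    have hm := hmin _ hmem
    have he : (1 - t) • θplus + t • s - θ₀ = (θplus - θ₀) + t • (s - θplus) := by module
    rw [he, norm_add_sq_real, inner_smul_right, norm_smul, mul_pow, ← hI, ← hN,
      Real.norm_eq_abs, sq_abs] at hm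
    simp only [smul_eq_mul] at hc
    have hc2 := mul_le_mul_of_nonneg_left hc hη.le
    have h1 : 0 ≤ t * (A + t * N / 2) := by rw [hAdef]; nlinarith
    have h2 : 0 ≤ A + t * N / 2 := nonneg_of_mul_nonneg_right h1 ht0
    nlinarith [mul_pos ht0 (neg_pos.2 hA)]
  have e : s - θ₀ = (θplus - θ₀) + (s - θplus) := by abel
  have h3 := norm_add_sq_real (θplus - θ₀) (s - θplus)
  rw [← e] at h3
  have h4 := le_trans (le_abs_self _) (hlip θ₀ hθ₀ θplus hθplus)
  rw [norm_sub_rev θ₀ θplus] at h4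
  rw [norm_sub_rev θ₀ s, norm_sub_rev θplus s]
  nlinarith [mul_le_mul_of_nonneg_left h4 hη.le, sq_nonneg (η * L - ‖θplus - θ₀‖)]
end
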